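/- Let α, β ∈ V. Suppose that for every complete separable metric space X and every Borel probability measure m on X, m has atoms α if and only if m has atoms β. Then α = β. (The correspondence α ↦ 𝒳_α from V to families of pm-spaces is injective.) -/

import Mathlib

open MeasureTheory ENNReal

/-- `m` has atoms `α` if there is `f : ℕ → X` with `∑_i α_i δ_{f(i)} ≤ m`. -/
def HasAtoms {X : Type} [MeasurableSpace X] (α : ℕ → ℝ) (m : Measure X) : Prop :=
  ∃ f : ℕ → X, Measure.sum (fun i => ENNReal.ofReal (α i) • Measure.dirac (f i)) ≤ m

/-- `V` : the set of nonincreasing nonnegative real sequences with ℓ¹-norm at most 1. -/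
def memV (a : ℕ → ℝ) : Prop :=
  (∀ i, 0 ≤ a i) ∧ (∀ i, a (i + 1) ≤ a i) ∧ ∀ N, ∑ i ∈ Finset.range N, a i ≤ 1

/-- The measure on `ℝ` with an atom of mass `α i` at each natural number `i`, and the remaining
mass spread uniformly over `[0, 1]`. -/
noncomputable def atomicMeasure (α : ℕ → ℝ) : Measure ℝ :=
  Measure.sum (fun i => ENNReal.ofReal (α i) • Measure.dirac (i : ℝ)) +
    (1 - ∑' i, ENNReal.ofReal (α i)) • volume.restrict (Set.Icc 0 1)

theorem memV.antitone {α : ℕ → ℝ} (hα : memV α) : Antitone α :=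
  antitone_nat_of_succ_le hα.2.1

theorem memV.tsum_ofReal_le_one {α : ℕ → ℝ} (hα : memV α) :
    ∑' i, ENNReal.ofReal (α i) ≤ 1 := by
  refine ENNReal.tsum_le_of_sum_range_le fun n => ?_
  rw [← ENNReal.ofReal_sum_of_nonneg fun i _ => hα.1 i]
  exact ENNReal.ofReal_le_one.2 (hα.2.2 n)

theorem isProbabilityMeasure_atomicMeasure {α : ℕ → ℝ} (hα : memV α) :
    IsProbabilityMeasure (atomicMeasure α) := by
  refine ⟨?_⟩
  simp [atomicMeasure, Measure.sum_apply, add_tsub_cancel_of_le hα.tsum_ofReal_le_one]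

theorem hasAtoms_atomicMeasure (α : ℕ → ℝ) : HasAtoms α (atomicMeasure α) :=
  ⟨fun i => (i : ℝ), Measure.le_add_right le_rfl⟩

theorem atomicMeasure_apply_of_countable (α : ℕ → ℝ) {s : Set ℝ} (hs : s.Countable) :
    atomicMeasure α s =
      ∑' i, ENNReal.ofReal (α i) * s.indicator (1 : ℝ → ℝ≥0∞) (i : ℝ) := by
  have hvol : volume.restrict (Set.Icc (0 : ℝ) 1) s = 0 := hs.measure_zero _
  simp [atomicMeasure, Measure.sum_apply _ hs.measurableSet, hvol,
    Measure.dirac_apply' _ hs.measurableSet]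

theorem atomicMeasure_singleton_le {α : ℕ → ℝ} (hα : memV α) {k : ℕ} {x : ℝ}
    (hx : ∀ i < k, x ≠ i) : atomicMeasure α {x} ≤ ENNReal.ofReal (α k) := by
  rw [atomicMeasure_apply_of_countable α (Set.countable_singleton x)]
  by_cases hn : ∃ j : ℕ, x = j
  · obtain ⟨j, rfl⟩ := hn
    rw [tsum_eq_single j fun i hi => by simp [hi]]
    have hkj : k ≤ j := not_lt.1 fun hj => hx j hj rfl
    simpa using ENNReal.ofReal_le_ofReal (hα.antitone hkj)
  · push Not at hn
    simp [fun i : ℕ => (hn i).symm]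

theorem atomicMeasure_image_range {α : ℕ → ℝ} (hα : memV α) (k : ℕ) :
    atomicMeasure α ((fun i : ℕ => (i : ℝ)) '' Set.Iio k) =
      ENNReal.ofReal (∑ i ∈ Finset.range k, α i) := by
  rw [atomicMeasure_apply_of_countable α (Set.to_countable _),
    tsum_eq_sum (s := Finset.range k) fun i hi => by
      simp [Set.indicator, Finset.mem_range.not.1 hi],
    ENNReal.ofReal_sum_of_nonneg fun i _ => hα.1 i]
  refine Finset.sum_congr rfl fun i hi => ?_
  simp [Set.indicator, Finset.mem_range.1 hi]

/-- If `f` witnesses that `m` has atoms `β`, the total mass of finitely many of the atoms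
lying in `s` is at most `m s`. -/
theorem ofReal_sum_le_of_sum_dirac_le {X : Type} [MeasurableSpace X] {β : ℕ → ℝ} {m : Measure X}
    (hβ : ∀ i, 0 ≤ β i) {f : ℕ → X}
    (hf : Measure.sum (fun i => ENNReal.ofReal (β i) • Measure.dirac (f i)) ≤ m)
    {s : Set X} (hs : MeasurableSet s) (t : Finset ℕ) (ht : ∀ i ∈ t, f i ∈ s) :
    ENNReal.ofReal (∑ i ∈ t, β i) ≤ m s := by
  refine le_trans ?_ (hf s)
  rw [Measure.sum_apply _ hs, ENNReal.ofReal_sum_of_nonneg fun i _ => hβ i]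
  refine le_trans (Finset.sum_le_sum fun i hi => ?_) (ENNReal.sum_le_tsum t)
  simp [Measure.dirac_apply' _ hs, ht i hi]

/-- If the measure built from `α` has atoms `β` and the two sequences agree before `k`,
then `β k ≤ α k`: otherwise the first `k + 1` atoms of `β` would fit into the first `k` of `α`. -/
theorem le_of_hasAtoms_atomicMeasure {α β : ℕ → ℝ} (hα : memV α) (hβ : memV β)
    (h : HasAtoms β (atomicMeasure α)) {k : ℕ} (hk : ∀ i < k, α i = β i) : β k ≤ α k := by
  obtain ⟨f, hf⟩ := h
  by_contra! hlt
  have hmem : ∀ i ∈ Finset.range (k + 1), f i ∈ (fun i : ℕ => (i : ℝ)) '' Set.Iio k := by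
    intro i hi
    by_contra hfi
    have hle := (ofReal_sum_le_of_sum_dirac_le hβ.1 hf (measurableSet_singleton (f i)) {i}
      (by simp)).trans (atomicMeasure_singleton_le hα fun j hj hij => hfi ⟨j, hj, hij.symm⟩)
    rw [Finset.sum_singleton, ENNReal.ofReal_le_ofReal_iff (hα.1 k)] at hle
    have hki := hβ.antitone (Finset.mem_range_succ_iff.1 hi)
    linarith
  have hsum := ofReal_sum_le_of_sum_dirac_le hβ.1 hf
    (Set.to_countable ((fun i : ℕ => (i : ℝ)) '' Set.Iio k)).measurableSet _ hmem
  rw [atomicMeasure_image_range hα,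
    ENNReal.ofReal_le_ofReal_iff (Finset.sum_nonneg fun i _ => hα.1 i), Finset.sum_range_succ,
    Finset.sum_congr rfl fun i hi => hk i (Finset.mem_range.1 hi)] at hsum
  linarith [hα.1 k]


/-- If `α, β ∈ V` and, for every complete separable metric space `X` with a Borel
probability measure `m`, `m` has atoms `α` iff `m` has atoms `β`, then `α = β`;
i.e. the correspondence `α ↦ 𝒳_α` is injective. -/
theorem atoms_correspondence_injective (α β : ℕ → ℝ) (hα : memV α) (hβ : memV β)
    (h : ∀ (X : Type) [MetricSpace X] [CompleteSpace X]
      [TopologicalSpace.SeparableSpace X] [MeasurableSpace X] [BorelSpace X]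
      (m : Measure X), IsProbabilityMeasure m → (HasAtoms α m ↔ HasAtoms β m)) :
    α = β := by
  funext k
  induction k using Nat.strong_induction_on with
  | _ k ih =>
    refine le_antisymm ?_ ?_
    · exact le_of_hasAtoms_atomicMeasure hβ hα
        ((h ℝ _ (isProbabilityMeasure_atomicMeasure hβ)).2 (hasAtoms_atomicMeasure β))
        fun i hi => (ih i hi).symm
    · exact le_of_hasAtoms_atomicMeasure hα hβ
        ((h ℝ _ (isProbabilityMeasure_atomicMeasure hα)).1 (hasAtoms_atomicMeasure α)) ih
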